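/- Suppose 𝒜 is in general position: n ≥ ℓ + 1, codim(H_{i_1} ∩ ⋯ ∩ H_{i_k}) = k (in particular the intersection is nonempty) for any k distinct hyperplanes with 1 ≤ k ≤ ℓ, and H_{i_1} ∩ ⋯ ∩ H_{i_k} = ∅ whenever k > ℓ. Then (so r = ℓ): (a) for every maximal X ∈ L, nbc_X = {B ∈ nbc : ⋂B = X} is a singleton (hence every linear order on 𝒜 is unmixed); (b) βnbc(𝒜) = {(H_{i_1}, …, H_{i_ℓ}) : 1 < i_1 < ⋯ < i_ℓ ≤ n}; (c) for every B = (H_{i_1}, …, H_{i_ℓ}) ∈ βnbc(𝒜) and every λ ∈ ℂ^n, Ξ(B) = λ_{i_1} λ_{i_2} ⋯ λ_{i_ℓ} · ω_B in A^ℓ. -/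

import Mathlib

open Module

noncomputable section

/-- An arrangement of `n` (affine) hyperplanes inside the ambient affine subspace `amb`
of the complex vector space `W`.  The linear order on the hyperplanes is the order of the
indices in `Fin n`; an arbitrary linear order is encoded by a permutation `σ` of `Fin n`,
with `i ≺ j ↔ σ i < σ j`. -/
structure HArr (W : Type) [AddCommGroup W] [Module ℂ W] (n : ℕ) where
  amb : AffineSubspace ℂ W
  amb_ne : (amb : Set W).Nonempty
  H : Fin n → AffineSubspace ℂ W
  inj : Function.Injective H
  le_amb : ∀ i, H i ≤ amb
  nonemptyH : ∀ i, ((H i : Set W)).Nonempty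
  hyp : ∀ i, finrank ℂ (H i).direction + 1 = finrank ℂ amb.direction

namespace HArr

variable {W : Type} [AddCommGroup W] [Module ℂ W] {n : ℕ}

/-- The intersection `⋂ S` of a subset of the arrangement (the ambient space for `S = ∅`). -/
def inter (A : HArr W n) (S : Finset (Fin n)) : AffineSubspace ℂ W :=
  A.amb ⊓ S.inf A.H

/-- Codimension (inside the ambient space) of an affine subspace. -/
def cd (A : HArr W n) (X : AffineSubspace ℂ W) : ℕ :=
  finrank ℂ A.amb.direction - finrank ℂ X.direction

/-- A dependent subset of the arrangement. -/
def dep (A : HArr W n) (S : Finset (Fin n)) : Prop :=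
  A.inter S ≠ ⊥ ∧ A.cd (A.inter S) < S.card

/-- An independent subset of the arrangement. -/
def indep (A : HArr W n) (S : Finset (Fin n)) : Prop :=
  A.inter S ≠ ⊥ ∧ A.cd (A.inter S) = S.card

/-- A base: a maximal independent subset. -/
def isBase (A : HArr W n) (S : Finset (Fin n)) : Prop :=
  A.indep S ∧ ∀ T, A.indep T → S ⊆ T → S = T

open scoped Classical in
/-- The rank of a subarrangement `{H i : i ∈ C}`. -/
def rankOn (A : HArr W n) (C : Finset (Fin n)) : ℕ :=
  C.powerset.sup fun S => if A.indep S then S.card else 0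

/-- The rank `r` of the arrangement. -/
def rank (A : HArr W n) : ℕ := A.rankOn Finset.univ

/-- A circuit: an inclusion-minimal dependent set. -/
def circuit (A : HArr W n) (S : Finset (Fin n)) : Prop :=
  A.dep S ∧ ∀ T ⊂ S, ¬ A.dep T

/-- A broken circuit w.r.t. the linear order given by `σ`. -/
def brokenCircuit (A : HArr W n) (σ : Equiv.Perm (Fin n)) (S : Finset (Fin n)) : Prop :=
  ∃ i ∉ S, (∀ j ∈ S, σ i < σ j) ∧ A.circuit (insert i S)

/-- An nbc set: nonempty intersection and containing no broken circuit. -/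
def nbcSet (A : HArr W n) (σ : Equiv.Perm (Fin n)) (S : Finset (Fin n)) : Prop :=
  A.inter S ≠ ⊥ ∧ ∀ T ⊆ S, ¬ A.brokenCircuit σ T

/-- An nbc-base. -/
def nbcBase (A : HArr W n) (σ : Equiv.Perm (Fin n)) (S : Finset (Fin n)) : Prop :=
  A.nbcSet σ S ∧ A.isBase S

/-- A βnbc-base. -/
def betaNbcBase (A : HArr W n) (σ : Equiv.Perm (Fin n)) (S : Finset (Fin n)) : Prop :=
  A.nbcBase σ S ∧ ∀ i ∈ S, ∃ j, σ j < σ i ∧ A.isBase (insert j (S.erase i))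

/-- Membership in the intersection poset `L(𝒜)`. -/
def memL (A : HArr W n) (X : AffineSubspace ℂ W) : Prop :=
  X ≠ ⊥ ∧ ∃ S : Finset (Fin n), A.inter S = X

/-- A maximal element of `L(𝒜)` (in the reverse-inclusion order). -/
def maximalL (A : HArr W n) (X : AffineSubspace ℂ W) : Prop :=
  A.memL X ∧ ∀ Y, A.memL Y → Y ≤ X → Y = X

open scoped Classical in
/-- The set of indices of hyperplanes containing `X`, i.e. `𝒜_X`. -/
def sub (A : HArr W n) (X : AffineSubspace ℂ W) : Finset (Fin n) :=
  Finset.univ.filter fun i => X ≤ A.H i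

/-- `X` is dense: `𝒜_X` admits no decomposition into two nonempty parts. -/
def denseL (A : HArr W n) (X : AffineSubspace ℂ W) : Prop :=
  ¬ ∃ S T : Finset (Fin n), Disjoint S T ∧ S.Nonempty ∧ T.Nonempty ∧
      S ∪ T = A.sub X ∧ A.cd (A.inter S) + A.cd (A.inter T) = A.cd X

/-- `i` is the minimum of `S` w.r.t. the linear order given by `σ`. -/
def isMin (σ : Equiv.Perm (Fin n)) (i : Fin n) (S : Finset (Fin n)) : Prop :=
  i ∈ S ∧ ∀ j ∈ S, σ i ≤ σ j

/-- The standard ordered tuple of a finite set, w.r.t. the linear order given by `σ`: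
`tup σ S p` is the element of `S` with `(p+1)`-st smallest `σ`-value. -/
def tup (σ : Equiv.Perm (Fin n)) (S : Finset (Fin n)) (p : Fin S.card) : Fin n :=
  σ.symm (((S.image ⇑σ).orderIsoOfFin (Finset.card_image_of_injective S σ.injective) p).1)

/-- The flag `ξ(B) = (X_1 > ⋯ > X_r)` of a standard ordered base:
`flag σ S p = X_{p+1} = ⋂_{k ≥ p} H_{i_k}`. -/
def flag (A : HArr W n) (σ : Equiv.Perm (Fin n)) (S : Finset (Fin n)) (p : Fin S.card) :
    AffineSubspace ℂ W :=
  A.inter (S.filter fun i => σ (tup σ S p) ≤ σ i)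

/-- Lexicographic order on standard ordered tuples (for the canonical order). -/
def lexLt (S T : Finset (Fin n)) : Prop :=
  List.Lex (· < ·) (S.sort (· ≤ ·)) (T.sort (· ≤ ·))

/-- `λ(X) = Σ_{H_i ∈ 𝒜_X} λ_i`. -/
def lamX (A : HArr W n) (lam : Fin n → ℂ) (X : AffineSubspace ℂ W) : ℂ :=
  ∑ i ∈ A.sub X, lam i

/-- `X` is unmixed (w.r.t. the order `σ`). -/
def unmixedX (A : HArr W n) (σ : Equiv.Perm (Fin n)) (X : AffineSubspace ℂ W) : Prop :=
  (∀ S, A.nbcBase σ S → A.inter S = X → A.betaNbcBase σ S) ∨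
  (∀ S, A.nbcBase σ S → A.inter S = X → ¬ A.betaNbcBase σ S)

/-- The linear order given by `σ` is unmixed. -/
def unmixedOrd (A : HArr W n) (σ : Equiv.Perm (Fin n)) : Prop :=
  ∀ X, A.maximalL X → A.unmixedX σ X

/-- Membership in the intersection poset of the deleted arrangement `𝒜 ∖ {H_{i₀}}`. -/
def memLdel (A : HArr W n) (i₀ : Fin n) (X : AffineSubspace ℂ W) : Prop :=
  X ≠ ⊥ ∧ ∃ S : Finset (Fin n), i₀ ∉ S ∧ A.inter S = X

/-- A maximal element of the intersection poset of the deleted arrangement. -/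
def maximalLdel (A : HArr W n) (i₀ : Fin n) (X : AffineSubspace ℂ W) : Prop :=
  A.memLdel i₀ X ∧ ∀ Y, A.memLdel i₀ Y → Y ≤ X → Y = X

/-- The generator `e_i` of the exterior algebra `E`. -/
def gen (i : Fin n) : ExteriorAlgebra ℂ (Fin n → ℂ) :=
  ExteriorAlgebra.ι ℂ (Pi.single i 1)

/-- `e_S = e_{i_1} ∧ ⋯ ∧ e_{i_p}` for `S = {i_1 < ⋯ < i_p}`. -/
def eS (S : Finset (Fin n)) : ExteriorAlgebra ℂ (Fin n → ℂ) :=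
  ((S.sort (· ≤ ·)).map gen).prod

/-- `∂e_S = Σ_k (−1)^{k−1} e_{S ∖ {i_k}}`. -/
def bdry (S : Finset (Fin n)) : ExteriorAlgebra ℂ (Fin n → ℂ) :=
  ∑ i ∈ S, ((-1 : ℂ) ^ (S.filter fun j => j < i).card) • eS (S.erase i)

/-- The defining relations of the Orlik–Solomon algebra. -/
inductive OSRel (A : HArr W n) :
    ExteriorAlgebra ℂ (Fin n → ℂ) → ExteriorAlgebra ℂ (Fin n → ℂ) → Prop
  | isBot : ∀ S : Finset (Fin n), A.inter S = ⊥ → OSRel A (eS S) 0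
  | isDep : ∀ S : Finset (Fin n), A.dep S → OSRel A (bdry S) 0

/-- The Orlik–Solomon algebra `A(𝒜)`: the exterior algebra modulo the ideal generated by
the `e_S` with empty intersection and the `∂e_S` with `S` dependent. -/
abbrev OS (A : HArr W n) := RingQuot (OSRel A)

/-- The quotient map `E → A(𝒜)`. -/
def osMk (A : HArr W n) : ExteriorAlgebra ℂ (Fin n → ℂ) →ₐ[ℂ] OS A :=
  RingQuot.mkAlgHom ℂ (OSRel A)

/-- `ω_i`, the image of `e_i` in the Orlik–Solomon algebra. -/
def om (A : HArr W n) (i : Fin n) : OS A := osMk A (gen i)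

/-- `ω_B`, the image of `e_B` in the Orlik–Solomon algebra. -/
def omB (A : HArr W n) (S : Finset (Fin n)) : OS A := osMk A (eS S)

/-- The degree `p` part `A^p` of the Orlik–Solomon algebra. -/
def deg (A : HArr W n) (p : ℕ) : Submodule ℂ (OS A) :=
  Submodule.span ℂ {x | ∃ S : Finset (Fin n), S.card = p ∧ x = omB A S}

/-- `ω_λ = Σ_i λ_i ω_i`. -/
def omLam (A : HArr W n) (lam : Fin n → ℂ) : OS A := ∑ i, lam i • om A i

/-- `ω_λ(X) = Σ_{H_i ∈ 𝒜_X} λ_i ω_i`. -/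
def omLamX (A : HArr W n) (lam : Fin n → ℂ) (X : AffineSubspace ℂ W) : OS A :=
  ∑ i ∈ A.sub X, lam i • om A i

/-- The form `Ξ(B) = ω_λ(X_1) ⋯ ω_λ(X_r)` attached to a standard ordered base. -/
def Xi (A : HArr W n) (σ : Equiv.Perm (Fin n)) (lam : Fin n → ℂ) (S : Finset (Fin n)) :
    OS A :=
  ((List.finRange S.card).map fun p => A.omLamX lam (A.flag σ S p)).prod

/-- The submodule `ω_λ ∧ A^p` of the Orlik-Solomon algebra. -/
def Ideg (A : HArr W n) (lam : Fin n → ℂ) (p : ℕ) : Submodule ℂ (OS A) :=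
  (A.deg p).map (LinearMap.mulLeft ℂ (A.omLam lam))

end HArr

namespace HArr

variable {W : Type} [AddCommGroup W] [Module ℂ W] {n : ℕ}

lemma gen_mul_prod_eq_zero (i : Fin n) (l : List (Fin n)) (hi : i ∈ l) :
    gen i * (l.map gen).prod = 0 := by
  induction l with
  | nil => simp at hi
  | cons a l ih =>
    rw [List.map_cons, List.prod_cons, ← mul_assoc]
    rcases List.mem_cons.1 hi with rfl | h
    · simp [gen]
    · have hswap : gen i * gen a = -(gen a * gen i) :=
        eq_neg_of_add_eq_zero_left (ExteriorAlgebra.ι_add_mul_swap _ _)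
      rw [hswap, neg_mul, mul_assoc, ih h, mul_zero, neg_zero]

/-- The product of the tail sums of a strictly increasing list collapses to a monomial. -/
lemma prod_tail_sums (lam : Fin n → ℂ) (l : List (Fin n)) (hl : l.Pairwise (· < ·)) :
    ((List.finRange l.length).map fun p =>
      ∑ i ∈ l.toFinset.filter (fun i => l[p] ≤ i), lam i • gen i).prod =
    (l.map lam).prod • (l.map gen).prod := by
  induction l with
  | nil => simp
  | cons a l ih =>
    obtain ⟨ha, hl⟩ := List.pairwise_cons.1 hl
    have hal : a ∉ l.toFinset := fun h => lt_irrefl a (ha a (List.mem_toFinset.1 h))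
    have hhead : (a :: l).toFinset.filter (fun i => a ≤ i) = insert a l.toFinset := by
      ext i
      simp only [List.toFinset_cons, Finset.mem_filter, Finset.mem_insert, List.mem_toFinset]
      constructor
      · exact fun h => h.1
      · rintro (rfl | h)
        · exact ⟨Or.inl rfl, le_rfl⟩
        · exact ⟨Or.inr h, (ha i h).le⟩
    have htail : ∀ p : Fin l.length, (a :: l).toFinset.filter (fun i => l[p] ≤ i) =
        l.toFinset.filter (fun i => l[p] ≤ i) := by
      intro p
      have hlt : ¬ l[p] ≤ a := not_le.2 (ha _ (List.getElem_mem _))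
      rw [List.toFinset_cons, Finset.filter_insert, if_neg hlt]
    have hzero : (∑ i ∈ l.toFinset, lam i • gen i) * (l.map gen).prod = 0 := by
      rw [Finset.sum_mul]
      refine Finset.sum_eq_zero fun i hi => ?_
      rw [smul_mul_assoc, gen_mul_prod_eq_zero i l (List.mem_toFinset.1 hi), smul_zero]
    have hcons : ((List.finRange (a :: l).length).map fun p =>
        ∑ i ∈ (a :: l).toFinset.filter (fun i => (a :: l)[p] ≤ i), lam i • gen i).prod =
        (∑ i ∈ (a :: l).toFinset.filter (fun i => a ≤ i), lam i • gen i) *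
        ((List.finRange l.length).map fun p =>
          ∑ i ∈ (a :: l).toFinset.filter (fun i => l[p] ≤ i), lam i • gen i).prod := by
      change ((List.finRange (l.length + 1)).map _).prod = _
      rw [List.finRange_succ, List.map_cons, List.prod_cons, List.map_map]
      rfl
    rw [hcons, hhead]
    simp only [htail]
    rw [ih hl, Finset.sum_insert hal, add_mul, mul_smul_comm, mul_smul_comm, hzero, smul_zero,
      add_zero, smul_mul_assoc, smul_smul, List.map_cons, List.prod_cons, List.map_cons,
      List.prod_cons, mul_comm]

lemma tup_one (S : Finset (Fin n)) (p : Fin S.card) :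
    tup 1 S p = (S.sort (· ≤ ·))[p.1]'(by simp) := by
  have h : S.image (1 : Equiv.Perm (Fin n)) = S := by ext; simp
  have key : ∀ (T : Finset (Fin n)) (hT : T.card = S.card), T = S →
      (T.orderIsoOfFin hT p).1 = (S.sort (· ≤ ·))[p.1]'(by simp) := by
    rintro T hT rfl
    rfl
  exact key _ (Finset.card_image_of_injective S (1 : Equiv.Perm (Fin n)).injective) h

lemma Xi_one_eq_of_sub_inter (A : HArr W n) (lam : Fin n → ℂ) (S : Finset (Fin n))
    (hsub : ∀ T ⊆ S, T.Nonempty → A.sub (A.inter T) = T) :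
    A.Xi 1 lam S = (∏ i ∈ S, lam i) • A.omB S := by
  have hfactor : ∀ p : Fin S.card, A.omLamX lam (A.flag 1 S p) =
      A.osMk (∑ i ∈ S.filter (fun i => (S.sort (· ≤ ·))[p.1]'(by simp) ≤ i),
        lam i • gen i) := by
    intro p
    have hmem : (S.sort (· ≤ ·))[p.1]'(by simp) ∈ S :=
      (Finset.mem_sort (· ≤ ·)).1 (List.getElem_mem _)
    unfold omLamX flag
    simp only [tup_one, Equiv.Perm.one_apply]
    rw [hsub _ (Finset.filter_subset _ _) ⟨_, Finset.mem_filter.2 ⟨hmem, le_rfl⟩⟩]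
    simp only [map_sum, map_smul, om]
  have hlist : ∀ (l : List (Fin n)) (k : ℕ) (hk : k = l.length), l.Pairwise (· < ·) →
      ((List.finRange k).map fun p : Fin k =>
        ∑ i ∈ l.toFinset.filter (fun i => l[p.1]'(hk ▸ p.2) ≤ i), lam i • gen i).prod =
      (l.map lam).prod • (l.map gen).prod := by
    rintro l k rfl hl
    exact prod_tail_sums lam l hl
  have hS := hlist (S.sort (· ≤ ·)) S.card (by simp) S.sortedLT_sort.pairwise
  rw [Finset.sort_toFinset] at hS
  have hprod : ((S.sort (· ≤ ·)).map lam).prod = ∏ i ∈ S, lam i := by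
    rw [← List.prod_toFinset lam (S.sort_nodup _), Finset.sort_toFinset]
  rw [hprod] at hS
  unfold Xi omB eS
  simp only [hfactor]
  rw [← map_smul, ← hS, map_list_prod, List.map_map]
  rfl

lemma inter_insert (A : HArr W n) (i : Fin n) (S : Finset (Fin n)) :
    A.inter (insert i S) = A.H i ⊓ A.inter S := by
  rw [inter, inter, Finset.inf_insert, inf_left_comm]

lemma inter_anti (A : HArr W n) {S T : Finset (Fin n)} (h : S ⊆ T) : A.inter T ≤ A.inter S :=
  inf_le_inf_left _ (Finset.inf_mono h)

lemma inter_le_H (A : HArr W n) {i : Fin n} {S : Finset (Fin n)} (h : i ∈ S) :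
    A.inter S ≤ A.H i :=
  inf_le_right.trans (Finset.inf_le h)

lemma inter_empty (A : HArr W n) : A.inter ∅ = A.amb := by simp [inter]

lemma indep_empty (A : HArr W n) : A.indep ∅ := by
  refine ⟨?_, ?_⟩
  · rw [inter_empty]
    exact (AffineSubspace.nonempty_iff_ne_bot _).1 A.amb_ne
  · rw [inter_empty, cd, Nat.sub_self, Finset.card_empty]

/-- The arrangement is generic: the sets with nonempty intersection are exactly those of size at
most `d`, and all of these are independent. -/
structure Generic (A : HArr W n) (d : ℕ) : Prop where
  indep_of_card_le : ∀ S : Finset (Fin n), S.card ≤ d → A.indep S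
  inter_eq_bot : ∀ S : Finset (Fin n), d < S.card → A.inter S = ⊥

namespace Generic

variable {A : HArr W n} {d : ℕ}

lemma card_le (hA : A.Generic d) {S : Finset (Fin n)} (h : A.inter S ≠ ⊥) : S.card ≤ d :=
  not_lt.1 fun hlt => h (hA.inter_eq_bot S hlt)

lemma not_dep (hA : A.Generic d) (S : Finset (Fin n)) : ¬ A.dep S := fun h =>
  h.2.ne (hA.indep_of_card_le S (hA.card_le h.1)).2

lemma isBase_iff (hA : A.Generic d) (hd : d ≤ n) (S : Finset (Fin n)) :
    A.isBase S ↔ S.card = d := by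
  constructor
  · intro h
    obtain ⟨T, hST, hT⟩ := Finset.exists_superset_card_eq (hA.card_le h.1.1)
      (by simpa using hd)
    rw [h.2 T (hA.indep_of_card_le T hT.le) hST, hT]
  · intro h
    refine ⟨hA.indep_of_card_le S h.le, fun T hT hST => Finset.eq_of_subset_of_card_le hST ?_⟩
    rw [h]
    exact hA.card_le hT.1

lemma nbcBase_iff (hA : A.Generic d) (hd : d ≤ n) (σ : Equiv.Perm (Fin n)) (S : Finset (Fin n)) :
    A.nbcBase σ S ↔ S.card = d := by
  rw [nbcBase, hA.isBase_iff hd]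
  refine ⟨fun h => h.2, fun h => ⟨⟨(hA.indep_of_card_le S h.le).1, ?_⟩, h⟩⟩
  rintro T - ⟨i, -, -, hc⟩
  exact hA.not_dep _ hc.1

lemma sub_inter (hA : A.Generic d) {S : Finset (Fin n)} (hS : S.card ≤ d) :
    A.sub (A.inter S) = S := by
  ext i
  simp only [sub, Finset.mem_filter, Finset.mem_univ, true_and]
  refine ⟨fun h => ?_, A.inter_le_H⟩
  by_contra hi
  have heq : A.inter (insert i S) = A.inter S := by rw [inter_insert, inf_eq_right.2 h]
  have hS' := hA.indep_of_card_le S hS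
  have hcard := (hA.indep_of_card_le (insert i S) (hA.card_le (heq ▸ hS'.1))).2
  rw [heq, hS'.2, Finset.card_insert_of_notMem hi] at hcard
  omega

lemma inter_injOn (hA : A.Generic d) {S T : Finset (Fin n)} (hS : S.card ≤ d) (hT : T.card ≤ d)
    (h : A.inter S = A.inter T) : S = T := by
  rw [← hA.sub_inter hS, h, hA.sub_inter hT]

lemma existsUnique_nbcBase (hA : A.Generic d) (hd : d ≤ n) (σ : Equiv.Perm (Fin n))
    {X : AffineSubspace ℂ W} (hX : A.maximalL X) :
    ∃! S : Finset (Fin n), A.nbcBase σ S ∧ A.inter S = X := by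
  obtain ⟨⟨hne, S, rfl⟩, hmax⟩ := hX
  obtain ⟨T, hST, hT⟩ := Finset.exists_superset_card_eq (hA.card_le hne) (by simpa using hd)
  have hTX := hmax (A.inter T) ⟨(hA.indep_of_card_le T hT.le).1, T, rfl⟩ (A.inter_anti hST)
  refine ⟨T, ⟨(hA.nbcBase_iff hd σ T).2 hT, hTX⟩, ?_⟩
  rintro U ⟨hU, hUX⟩
  exact hA.inter_injOn ((hA.nbcBase_iff hd σ U).1 hU).le hT.le (hUX.trans hTX.symm)

lemma unmixedOrd (hA : A.Generic d) (hd : d ≤ n) (σ : Equiv.Perm (Fin n)) : A.unmixedOrd σ := by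
  intro X hX
  obtain ⟨S, -, huniq⟩ := hA.existsUnique_nbcBase hd σ hX
  by_cases hS : A.betaNbcBase σ S
  · exact Or.inl fun T hT hTX => huniq T ⟨hT, hTX⟩ ▸ hS
  · exact Or.inr fun T hT hTX => huniq T ⟨hT, hTX⟩ ▸ hS

lemma betaNbcBase_one_iff (hA : A.Generic d) (hd : d ≤ n) (S : Finset (Fin n)) :
    A.betaNbcBase 1 S ↔ S.card = d ∧ ∀ i ∈ S, 0 < (i : ℕ) := by
  simp only [betaNbcBase, hA.nbcBase_iff hd, hA.isBase_iff hd, Equiv.Perm.one_apply]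
  refine and_congr_right fun hS => ⟨fun h i hi => ?_, fun h i hi => ?_⟩
  · obtain ⟨j, hj, -⟩ := h i hi
    exact (Nat.zero_le _).trans_lt hj
  · have hn : 0 < n := (Nat.zero_le _).trans_lt i.2
    have h0 : (⟨0, hn⟩ : Fin n) ∉ S.erase i := fun hmem =>
      lt_irrefl 0 (h _ (Finset.mem_of_mem_erase hmem))
    refine ⟨⟨0, hn⟩, h i hi, ?_⟩
    rw [Finset.card_insert_of_notMem h0, Finset.card_erase_add_one hi, hS]

end Generic

end HArr

open scoped Classical
/-- If `𝒜` is in general position then (a) `nbc_X` is a singleton for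
every maximal `X ∈ L` and every linear order on `𝒜` is unmixed; (b) the βnbc-bases are
exactly the `ℓ`-subsets avoiding `H_1`; (c) `Ξ(B) = λ_{i_1} ⋯ λ_{i_ℓ} · ω_B` for every
`B ∈ βnbc(𝒜)` and every `λ`. -/
theorem general_position_betaNbc {W : Type} [AddCommGroup W] [Module ℂ W]
    [FiniteDimensional ℂ W] {n : ℕ} (A : HArr W n)
    (hcard : finrank ℂ A.amb.direction + 1 ≤ n)
    (hgp : ∀ S : Finset (Fin n), S.Nonempty → S.card ≤ finrank ℂ A.amb.direction →
      A.inter S ≠ ⊥ ∧ A.cd (A.inter S) = S.card)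
    (hempty : ∀ S : Finset (Fin n), finrank ℂ A.amb.direction < S.card →
      A.inter S = ⊥) :
    ((∀ X, A.maximalL X →
        ∃! S : Finset (Fin n), A.nbcBase 1 S ∧ A.inter S = X) ∧
      (∀ σ : Equiv.Perm (Fin n), A.unmixedOrd σ)) ∧
    (∀ S : Finset (Fin n), A.betaNbcBase 1 S ↔
      S.card = finrank ℂ A.amb.direction ∧ ∀ i ∈ S, 0 < (i : ℕ)) ∧
    (∀ lam : Fin n → ℂ, ∀ S : Finset (Fin n), A.betaNbcBase 1 S →
      A.Xi 1 lam S = (∏ i ∈ S, lam i) • A.omB S) := by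
  have hA : A.Generic (finrank ℂ A.amb.direction) := by
    refine ⟨fun S hS => ?_, hempty⟩
    rcases S.eq_empty_or_nonempty with rfl | hne
    · exact A.indep_empty
    · exact hgp S hne hS
  have hd : finrank ℂ A.amb.direction ≤ n := by omega
  refine ⟨⟨fun X hX => hA.existsUnique_nbcBase hd 1 hX, hA.unmixedOrd hd⟩,
    hA.betaNbcBase_one_iff hd, fun lam S hS => A.Xi_one_eq_of_sub_inter lam S fun T hT _ => ?_⟩
  exact hA.sub_inter ((Finset.card_le_card hT).trans ((hA.nbcBase_iff hd 1 S).1 hS.1).le)
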